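/- In any affine plane of order 6, the diagonals of every parallelogram are parallel: if A, B, C, D are four points, no three collinear, such that line AB is parallel to line CD and line BC is parallel to line AD, then line AC is parallel to line BD. -/

import Mathlib

/-- quaternionic 4-block transform multiplying the sum of squares by 6 -/
def qY (f : ℕ → ℚ) (i : ℕ) : ℚ :=
  if i % 4 = 0 then 2 * f i + f (i+1) + f (i+2)
  else if i % 4 = 1 then - f (i-1) + 2 * f i + f (i+2)
  else if i % 4 = 2 then - f (i-2) + 2 * f i - f (i+1)
  else - f (i-2) + f (i-1) + 2 * f i

lemma qY_sum (f : ℕ → ℚ) (m : ℕ) :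
    ∑ i ∈ Finset.range (4*m), (qY f i)^2 = 6 * ∑ i ∈ Finset.range (4*m), (f i)^2 := by
  induction m with
  | zero => simp
  | succ m ih =>
    have e : 4 * (m+1) = 4*m+1+1+1+1 := by ring
    rw [e]
    simp only [Finset.sum_range_succ]
    rw [ih]
    have h0 : qY f (4*m) = 2 * f (4*m) + f (4*m+1) + f (4*m+1+1) := by
      simp [qY]
    have h1 : qY f (4*m+1) = - f (4*m) + 2 * f (4*m+1) + f (4*m+1+1+1) := by
      have : (4*m+1) % 4 = 1 := by omega
      simp [qY, this]
    have h2 : qY f (4*m+1+1) = - f (4*m) + 2 * f (4*m+1+1) - f (4*m+1+1+1) := by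
      have : (4*m+1+1) % 4 = 2 := by omega
      simp [qY, this]
    have h3 : qY f (4*m+1+1+1) = - f (4*m+1) + f (4*m+1+1) + 2 * f (4*m+1+1+1) := by
      have : (4*m+1+1+1) % 4 = 3 := by omega
      simp [qY, this]
    rw [h0, h1, h2, h3]
    ring

lemma qY_add (f g : ℕ → ℚ) (i : ℕ) : qY (f + g) i = qY f i + qY g i := by
  unfold qY
  simp only [Pi.add_apply]
  split_ifs <;> ring

lemma qY_smul (c : ℚ) (f : ℕ → ℚ) (i : ℕ) : qY (c • f) i = c * qY f i := by
  unfold qY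
  simp only [Pi.smul_apply, smul_eq_mul]
  split_ifs <;> ring

/-- extension by zero -/
def ext44 (x : Fin 44 → ℚ) (i : ℕ) : ℚ := if h : i < 44 then x ⟨i, h⟩ else 0

lemma ext44_add (x y : Fin 44 → ℚ) : ext44 (x + y) = ext44 x + ext44 y := by
  funext i; simp only [ext44, Pi.add_apply]; split_ifs <;> simp

lemma ext44_smul (c : ℚ) (x : Fin 44 → ℚ) : ext44 (c • x) = c • ext44 x := by
  funext i; simp only [ext44, Pi.smul_apply]; split_ifs <;> simp

def yL (i : ℕ) : (Fin 44 → ℚ) →ₗ[ℚ] ℚ where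
  toFun x := qY (ext44 x) i
  map_add' x y := by rw [ext44_add, qY_add]
  map_smul' c x := by rw [ext44_smul, qY_smul]; simp

lemma yL_sum (x : Fin 44 → ℚ) :
    ∑ i ∈ Finset.range 44, (yL i x)^2 = 6 * ∑ i : Fin 44, (x i)^2 := by
  have h := qY_sum (ext44 x) 11
  norm_num at h
  change ∑ i ∈ Finset.range 44, (qY (ext44 x) i)^2 = _
  rw [h, Finset.sum_range]
  congr 1

lemma subspace_step (l : ℕ → (Fin 44 → ℚ) →ₗ[ℚ] ℚ) (k : ℕ) (hk : k ≤ 43) :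
    ∃ W : Submodule ℚ (Fin 44 → ℚ), 44 ≤ Module.finrank ℚ W + k ∧
      (∀ x ∈ W, ∀ j < k, (l j x)^2 = (yL j x)^2) ∧
      (∀ x ∈ W, (∀ j, k ≤ j → j < 44 → yL j x = 0) → x = 0) := by
  induction k with
  | zero =>
    refine ⟨⊤, by simp, by simp, ?_⟩
    intro x _ hx
    have h := yL_sum x
    have h0 : ∑ i ∈ Finset.range 44, (yL i x)^2 = 0 := by
      apply Finset.sum_eq_zero
      intro i hi
      rw [hx i (Nat.zero_le _) (Finset.mem_range.1 hi)]; norm_num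
    have h1 : ∑ i : Fin 44, (x i)^2 = 0 := by linarith
    rw [Finset.sum_eq_zero_iff_of_nonneg (fun i _ => sq_nonneg _)] at h1
    funext i
    have := h1 i (Finset.mem_univ _)
    simpa using this
  | succ k ih =>
    obtain ⟨W, hd, hs, hi⟩ := ih (by omega)
    have key : ∃ ε : ℚ, ε^2 = 1 ∧ ∀ x ∈ W, l k x = ε * yL k x →
        (∀ j, k+1 ≤ j → j < 44 → yL j x = 0) → x = 0 := by
      by_contra hcon
      push Not at hcon
      obtain ⟨x, hxW, hx1, hx2, hx3⟩ := hcon 1 (by norm_num)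
      obtain ⟨z, hzW, hz1, hz2, hz3⟩ := hcon (-1) (by norm_num)
      have aux : ∀ u ∈ W, (∀ j, k+1 ≤ j → j < 44 → yL j u = 0) → u ≠ 0 → yL k u ≠ 0 := by
        intro u hu h1 h2 h3
        apply h2
        apply hi u hu
        intro j hj hj'
        rcases Nat.eq_or_lt_of_le hj with h | h
        · rw [← h]; exact h3
        · exact h1 j h hj'
      have hx4 := aux x hxW hx2 hx3
      have hz4 := aux z hzW hz2 hz3
      have h5 : (yL k z) • x - (yL k x) • z = 0 := by
        apply hi _ (W.sub_mem (W.smul_mem _ hxW) (W.smul_mem _ hzW))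
        intro j hj hj'
        rw [map_sub, map_smul, map_smul]
        rcases Nat.eq_or_lt_of_le hj with h | h
        · rw [← h]; simp only [smul_eq_mul]; ring
        · rw [hx2 j h hj', hz2 j h hj']; simp
      have h6 := congrArg (l k) h5
      rw [map_sub, map_smul, map_smul, hx1, hz1, map_zero] at h6
      simp only [smul_eq_mul] at h6
      have : yL k x * yL k z = 0 := by linarith
      rcases mul_eq_zero.1 this with h | h
      · exact hx4 h
      · exact hz4 h
    obtain ⟨ε, hε, hinj⟩ := key
    let g : (Fin 44 → ℚ) →ₗ[ℚ] ℚ := l k - ε • yL k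
    have hg : ∀ x, x ∈ LinearMap.ker g ↔ l k x = ε * yL k x := by
      intro x
      simp [g, sub_eq_zero]
    refine ⟨W ⊓ LinearMap.ker g, ?_, ?_, ?_⟩
    · have h1 := Submodule.finrank_sup_add_finrank_inf_eq W (LinearMap.ker g)
      have h2 := LinearMap.finrank_range_add_finrank_ker g
      have h3 : Module.finrank ℚ (LinearMap.range g) ≤ 1 := by
        simpa using Submodule.finrank_le (LinearMap.range g)
      have h4 : Module.finrank ℚ ↥(W ⊔ LinearMap.ker g) ≤ 44 := by
        simpa using Submodule.finrank_le (W ⊔ LinearMap.ker g)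
      simp only [Module.finrank_fintype_fun_eq_card, Fintype.card_fin] at h2
      omega
    · intro x hx j hj
      rcases Nat.eq_or_lt_of_le (Nat.lt_succ_iff.1 hj) with h | h
      · rw [h, (hg x).1 hx.2, mul_pow, hε, one_mul]
      · exact hs x hx.1 j h
    · intro x hx h
      exact hinj x hx.1 ((hg x).1 hx.2) h

lemma sq_mod3 (a b : ℤ) (h : (3:ℤ) ∣ a^2 + b^2) : (3:ℤ) ∣ a ∧ (3:ℤ) ∣ b := by
  have h' : (a^2+b^2) % 3 = 0 := Int.emod_eq_zero_of_dvd h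
  have ha : a % 3 = 0 ∨ a % 3 = 1 ∨ a % 3 = 2 := by omega
  have hb : b % 3 = 0 ∨ b % 3 = 1 ∨ b % 3 = 2 := by omega
  rcases ha with ha | ha | ha <;> rcases hb with hb | hb | hb <;>
    simp [pow_two, Int.add_emod, Int.mul_emod, ha, hb] at h' <;> omega

lemma descent (n : ℕ) : ∀ u v y t : ℤ, u.natAbs + v.natAbs + y.natAbs + t.natAbs ≤ n →
    6 * (u^2 + v^2) = y^2 + t^2 → y = 0 := by
  induction n with
  | zero => intro u v y t h _; omega
  | succ n ih =>
    intro u v y t h e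
    obtain ⟨⟨y', rfl⟩, ⟨t', rfl⟩⟩ := sq_mod3 y t ⟨2 * (u^2+v^2), by linarith⟩
    have e2 : 2 * (u^2+v^2) = 3 * (y'^2+t'^2) := by nlinarith
    obtain ⟨⟨u', rfl⟩, ⟨v', rfl⟩⟩ := sq_mod3 u v (by omega)
    by_cases h0 : y' = 0
    · simp [h0]
    · have := ih u' v' y' t' (by omega) (by nlinarith)
      simp [this]

lemma descentQ (u v y t : ℚ) (h : 6 * (u^2+v^2) = y^2+t^2) : y = 0 := by
  have cl : ∀ q : ℚ, q * q.den = q.num := fun q => Rat.mul_den_eq_num q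
  have e : 6 * ((u.num * v.den * y.den * t.den : ℤ)^2 + (v.num * u.den * y.den * t.den : ℤ)^2)
      = (y.num * u.den * v.den * t.den : ℤ)^2 + (t.num * u.den * v.den * y.den : ℤ)^2 := by
    have : (6 * ((u.num * v.den * y.den * t.den)^2 + (v.num * u.den * y.den * t.den)^2) : ℚ)
      = (y.num * u.den * v.den * t.den)^2 + (t.num * u.den * v.den * y.den)^2 := by
      rw [← cl u, ← cl v, ← cl y, ← cl t]
      linear_combination (u.den * v.den * y.den * t.den : ℚ)^2 * h
    exact_mod_cast this
  have h1 := descent _ _ _ _ _ le_rfl e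
  simpa using h1

lemma no_matrix (N : Fin 43 → Fin 42 → ℚ)
    (h : ∀ a b, ∑ j, N j a * N j b = (if a = b then 6 else 0) + 1) : False := by
  let c : Fin 42 → Fin 44 := Fin.castLE (by norm_num)
  let lin : Fin 43 → (Fin 44 → ℚ) →ₗ[ℚ] ℚ := fun j => ∑ a, N j a • LinearMap.proj (c a)
  have hlin : ∀ j x, lin j x = ∑ a, N j a * x (c a) := by
    intro j x; simp [lin]
  let l : ℕ → (Fin 44 → ℚ) →ₗ[ℚ] ℚ := fun j => if hj : j < 43 then lin ⟨j, hj⟩ else 0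
  obtain ⟨W, hd, hs, hi⟩ := subspace_step l 43 le_rfl
  have hW : W ≠ ⊥ := by
    rintro rfl
    simp at hd
  obtain ⟨x, hxW, hx0⟩ := (Submodule.ne_bot_iff W).1 hW
  have hy : yL 43 x ≠ 0 := by
    intro h0
    apply hx0
    apply hi x hxW
    intro j h1 h2
    have : j = 43 := by omega
    rw [this]; exact h0
  have s1 : ∑ j, (lin j x)^2 = ∑ j ∈ Finset.range 43, (yL j x)^2 := by
    rw [Finset.sum_range]
    apply Finset.sum_congr rfl
    intro j _
    rw [← hs x hxW j j.2]
    simp [l]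
  have s2 : ∑ j, (lin j x)^2 = 6 * ∑ a, (x (c a))^2 + (∑ a, x (c a))^2 := by
    simp only [hlin, pow_two, Finset.sum_mul_sum]
    rw [Finset.sum_comm]
    simp_rw [Finset.sum_comm (s := (Finset.univ : Finset (Fin 43)))]
    have : ∀ a b, ∑ j, N j a * x (c a) * (N j b * x (c b)) =
        (if a = b then 6 * (x (c a) * x (c b)) else 0) + x (c a) * x (c b) := by
      intro a b
      have h1 : ∑ j, N j a * x (c a) * (N j b * x (c b)) =
        (∑ j, N j a * N j b) * (x (c a) * x (c b)) := by
        rw [Finset.sum_mul]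
        exact Finset.sum_congr rfl (fun j _ => by ring)
      rw [h1, h]
      split_ifs <;> ring
    simp_rw [this, Finset.sum_add_distrib]
    simp [Finset.mul_sum]
  have s3 := yL_sum x
  rw [Finset.sum_range_succ, ← s1, s2] at s3
  have s4 : ∑ i, (x i)^2 = ∑ a, (x (c a))^2 + (x 42)^2 + (x 43)^2 := by
    rw [Fin.sum_univ_castSucc, Fin.sum_univ_castSucc]
    rfl
  rw [s4] at s3
  apply hy
  apply descentQ (x 42) (x 43) (yL 43 x) (∑ a, x (c a))
  linarith

lemma no_matrix' {J I : Type*} [Fintype J] [Fintype I] [DecidableEq I]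
    (hJ : Fintype.card J = 43) (hI : Fintype.card I = 42) (N : J → I → ℚ)
    (h : ∀ a b, ∑ j, N j a * N j b = (if a = b then 6 else 0) + 1) : False := by
  let eJ := (Fintype.equivFinOfCardEq hJ).symm
  let eI := (Fintype.equivFinOfCardEq hI).symm
  apply no_matrix (fun j a => N (eJ j) (eI a))
  intro a b
  rw [Equiv.sum_comp eJ (fun j => N j (eI a) * N j (eI b)), h]
  simp

open Classical in
lemma no_plane {P : Type} (L : Set (Set P))
    (hu : ∀ p q : P, p ≠ q → ∃! ℓ, ℓ ∈ L ∧ p ∈ ℓ ∧ q ∈ ℓ)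
    (hp : ∀ ℓ ∈ L, ∀ p ∉ ℓ, ∃! ℓ', ℓ' ∈ L ∧ p ∈ ℓ' ∧ ℓ ∩ ℓ' = ∅)
    (ho : ∀ ℓ ∈ L, ℓ.ncard = 6)
    (A B C : P) (hAB : A ≠ B) (hAC : A ≠ C) (hBC : B ≠ C)
    (h3 : ∀ ℓ ∈ L, ¬(A ∈ ℓ ∧ B ∈ ℓ ∧ C ∈ ℓ)) : False := by
  have uniq : ∀ p q : P, p ≠ q → ∀ ℓ ∈ L, ∀ m ∈ L, p ∈ ℓ → q ∈ ℓ → p ∈ m → q ∈ m → ℓ = m :=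
    fun p q hpq ℓ hℓ m hm h1 h2 h3 h4 => (hu p q hpq).unique ⟨hℓ, h1, h2⟩ ⟨hm, h3, h4⟩
  have puniq : ∀ ℓ ∈ L, ∀ p ∉ ℓ, ∀ m ∈ L, ∀ k ∈ L, p ∈ m → p ∈ k → ℓ ∩ m = ∅ → ℓ ∩ k = ∅ →
      m = k :=
    fun ℓ hℓ p hpℓ m hm k hk h1 h2 h3 h4 => (hp ℓ hℓ p hpℓ).unique ⟨hm, h1, h3⟩ ⟨hk, h2, h4⟩
  have disj : ∀ (s t : Set P) (p : P), s ∩ t = ∅ → p ∈ s → p ∈ t → False := by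
    intro s t p h h1 h2
    have : p ∈ s ∩ t := ⟨h1, h2⟩
    rw [h] at this
    exact this
  have exl : ∀ p q : P, ∃ ℓ, p ≠ q → ℓ ∈ L ∧ p ∈ ℓ ∧ q ∈ ℓ := by
    intro p q
    by_cases h : p = q
    · exact ⟨∅, fun h' => absurd h h'⟩
    · obtain ⟨ℓ, hℓ, _⟩ := hu p q h
      exact ⟨ℓ, fun _ => hℓ⟩
  choose lin hlin using exl
  have hoff : ∀ p, ∃ ℓ ∈ L, p ∉ ℓ := by
    intro p
    by_contra hcon
    push Not at hcon
    obtain ⟨h1, h2, h3'⟩ := hlin A B hAB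
    obtain ⟨k1, k2, k3⟩ := hlin A C hAC
    obtain ⟨m1, m2, m3⟩ := hlin B C hBC
    by_cases hpA : p = A
    · subst hpA
      exact h3 _ m1 ⟨hcon _ m1, m2, m3⟩
    · have := uniq p A hpA _ h1 _ k1 (hcon _ h1) h2 (hcon _ k1) k2
      exact h3 _ k1 ⟨k2, this ▸ h3', k3⟩
  have hfinl : ∀ ℓ ∈ L, ℓ.Finite := by
    intro ℓ hℓ
    apply Set.finite_of_ncard_ne_zero
    rw [ho ℓ hℓ]; norm_num
  -- lines through a point
  have thru : ∀ p, ∀ ℓ ∈ L, p ∉ ℓ → ∀ k ∈ L, p ∈ k → ℓ ∩ k = ∅ ∨ ∃ q ∈ ℓ, k = lin p q := by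
    intro p ℓ hℓ hpℓ k hk hpk
    by_cases h : ℓ ∩ k = ∅
    · exact Or.inl h
    · right
      obtain ⟨q, hq1, hq2⟩ := Set.nonempty_iff_ne_empty.2 h
      have hpq : p ≠ q := by rintro rfl; exact hpℓ hq1
      obtain ⟨a1, a2, a3⟩ := hlin p q hpq
      exact ⟨q, hq1, uniq p q hpq _ hk _ a1 hpk hq2 a2 a3⟩
  have hfinP : Finite P := by
    obtain ⟨ℓ, hℓ, hA⟩ := hoff A
    obtain ⟨m, ⟨hm, hAm, hmℓ⟩, -⟩ := hp ℓ hℓ A hA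
    apply Set.finite_univ_iff.1
    apply Set.Finite.subset ((hfinl m hm).union
      (Set.Finite.biUnion (hfinl ℓ hℓ) (t := fun q => lin A q) ?_))
    · intro x _
      by_cases hx : A = x
      · left; exact hx ▸ hAm
      · obtain ⟨a1, a2, a3⟩ := hlin A x hx
        rcases thru A ℓ hℓ hA _ a1 a2 with h | ⟨q, hq, h⟩
        · left
          rw [puniq ℓ hℓ A hA m hm _ a1 hAm a2 hmℓ h]
          exact a3
        · right
          exact Set.mem_biUnion hq (h ▸ a3)
    · intro q hq
      have hpq : A ≠ q := by rintro rfl; exact hA hq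
      exact hfinl _ (hlin A q hpq).1
  haveI : Fintype P := Fintype.ofFinite P
  let I := {ℓ : Set P // ℓ ∈ L}
  haveI : Fintype I := Fintype.ofFinite I
  have c6 : ∀ ℓ : I, (Finset.univ.filter (fun p => p ∈ ℓ.1)).card = 6 := by
    intro ℓ
    rw [← ho ℓ.1 ℓ.2, ← Set.ncard_coe_finset]
    congr 1
    ext; simp
  have c7 : ∀ p : P, (Finset.univ.filter (fun ℓ : I => p ∈ ℓ.1)).card = 7 := by
    intro p
    obtain ⟨ℓ, hℓ, hpℓ⟩ := hoff p
    obtain ⟨m, ⟨hm, hpm, hmℓ⟩, -⟩ := hp ℓ hℓ p hpℓ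
    have hne : ∀ q ∈ ℓ, p ≠ q := by rintro q hq rfl; exact hpℓ hq
    have him : (Finset.univ.filter (fun ℓ : I => p ∈ ℓ.1)).card =
        ((Finset.univ.filter (fun k : Set P => k ∈ L ∧ p ∈ k))).card := by
      rw [← Finset.card_map (Function.Embedding.subtype (fun ℓ : Set P => ℓ ∈ L))]
      congr 1
      ext k
      simp [and_comm]
    rw [him]
    have hS : (Finset.univ.filter (fun k : Set P => k ∈ L ∧ p ∈ k)) =
        insert m ((Finset.univ.filter (fun q => q ∈ ℓ)).image (lin p)) := by
      ext k
      simp only [Finset.mem_filter, Finset.mem_univ, true_and, Finset.mem_insert,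
        Finset.mem_image]
      constructor
      · rintro ⟨hk, hpk⟩
        rcases thru p ℓ hℓ hpℓ k hk hpk with h | ⟨q, hq, h⟩
        · left; exact puniq ℓ hℓ p hpℓ k hk m hm hpk hpm h hmℓ
        · right; exact ⟨q, hq, h.symm⟩
      · rintro (rfl | ⟨q, hq, rfl⟩)
        · exact ⟨hm, hpm⟩
        · have := hlin p q (hne q hq)
          exact ⟨this.1, this.2.1⟩
    rw [hS, Finset.card_insert_of_notMem, Finset.card_image_of_injOn]
    · rw [c6 ⟨ℓ, hℓ⟩]
    · intro q hq r hr hqr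
      simp only [Finset.coe_filter, Finset.mem_univ, true_and, Set.mem_ofPred_eq] at hq hr
      by_contra hne'
      obtain ⟨a1, a2, a3⟩ := hlin p q (hne q hq)
      obtain ⟨b1, b2, b3⟩ := hlin p r (hne r hr)
      have hqr' : lin p q = lin p r := hqr
      have := uniq q r hne' _ a1 ℓ hℓ a3 (hqr' ▸ b3) hq hr
      exact hpℓ (this ▸ a2)
    · intro h
      simp only [Finset.mem_filter, Finset.mem_univ, true_and, Finset.mem_image] at h
      obtain ⟨q, hq, rfl⟩ := h
      exact disj _ _ q hmℓ hq (hlin p q (hne q hq)).2.2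
  have cP : Fintype.card P = 36 := by
    have e := Finset.sum_card_bipartiteAbove_eq_sum_card_bipartiteBelow
      (s := Finset.univ.filter (fun ℓ : I => A ∈ ℓ.1)) (t := (Finset.univ : Finset P))
      (fun (ℓ : I) (p : P) => p ∈ ℓ.1)
    simp only [Finset.bipartiteAbove, Finset.bipartiteBelow, c6, Finset.sum_const, c7] at e
    rw [← Finset.add_sum_erase _ _ (Finset.mem_univ A)] at e
    have e1 : ((Finset.univ.filter (fun ℓ : I => A ∈ ℓ.1)).filter (fun ℓ : I => A ∈ ℓ.1)).card
        = 7 := by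
      rw [Finset.filter_filter]; simp only [and_self]; exact c7 A
    rw [e1] at e
    have e2 : ∀ p ∈ Finset.univ.erase A,
        ((Finset.univ.filter (fun ℓ : I => A ∈ ℓ.1)).filter (fun ℓ : I => p ∈ ℓ.1)).card = 1 := by
      intro p hp'
      have hAp : A ≠ p := (Finset.ne_of_mem_erase hp').symm
      obtain ⟨a1, a2, a3⟩ := hlin A p hAp
      rw [Finset.card_eq_one]
      refine ⟨⟨lin A p, a1⟩, ?_⟩
      ext k
      simp only [Finset.mem_filter, Finset.mem_univ, true_and, Finset.mem_singleton]
      constructor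
      · rintro ⟨h1, h2⟩
        exact Subtype.ext (uniq A p hAp _ k.2 _ a1 h1 h2 a2 a3)
      · rintro rfl; exact ⟨a2, a3⟩
    rw [Finset.sum_congr rfl e2] at e
    simp only [Finset.sum_const, Finset.card_erase_of_mem (Finset.mem_univ A),
      Finset.card_univ, smul_eq_mul] at e
    omega
  have cI : Fintype.card I = 42 := by
    have e := Finset.sum_card_bipartiteAbove_eq_sum_card_bipartiteBelow
      (s := (Finset.univ : Finset I)) (t := (Finset.univ : Finset P))
      (fun (ℓ : I) (p : P) => p ∈ ℓ.1)
    simp only [Finset.bipartiteAbove, Finset.bipartiteBelow, c6, Finset.sum_const, c7,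
      Finset.card_univ, smul_eq_mul, cP] at e
    omega
  have cJ : Fintype.card (P ⊕ {ℓ : I // A ∈ ℓ.1}) = 43 := by
    rw [Fintype.card_sum, cP, Fintype.card_subtype, c7]
  -- the parallel through `A`
  have hπ : ∀ a : I, ∃ c : {ℓ : I // A ∈ ℓ.1}, ∀ d : {ℓ : I // A ∈ ℓ.1},
      (a.1 = d.1.1 ∨ a.1 ∩ d.1.1 = ∅) ↔ d = c := by
    intro a
    by_cases hA : A ∈ a.1
    · refine ⟨⟨a, hA⟩, fun d => ⟨?_, ?_⟩⟩
      · rintro (h | h)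
        · exact Subtype.ext (Subtype.ext h.symm)
        · exact (disj _ _ A h hA d.2).elim
      · rintro rfl; left; rfl
    · obtain ⟨m, ⟨hm, hAm, hmℓ⟩, -⟩ := hp a.1 a.2 A hA
      refine ⟨⟨⟨m, hm⟩, hAm⟩, fun d => ⟨?_, ?_⟩⟩
      · rintro (h | h)
        · exact (hA (h ▸ d.2)).elim
        · exact Subtype.ext (Subtype.ext
            (puniq a.1 a.2 A hA d.1.1 d.1.2 m hm d.2 hAm h hmℓ))
      · rintro rfl; right; exact hmℓ
  choose π hπ using hπ
  have πeq : ∀ a b : I, π a = π b ↔ (a = b ∨ a.1 ∩ b.1 = ∅) := by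
    intro a b
    have ha := (hπ a (π a)).2 rfl
    constructor
    · intro h
      have hb := (hπ b (π a)).2 h
      by_contra hcon
      push Not at hcon
      obtain ⟨hab, hn⟩ := hcon
      obtain ⟨p, hpa, hpb⟩ := hn
      have hab' : a.1 ≠ b.1 := fun h => hab (Subtype.ext h)
      rcases ha with ha | ha <;> rcases hb with hb | hb
      · exact hab' (ha.trans hb.symm)
      · rw [← ha] at hb; exact disj _ _ p hb hpb hpa
      · rw [← hb] at ha; exact disj _ _ p ha hpa hpb
      · have hpc : p ∉ (π a).1.1 := fun h => disj _ _ p ha hpa h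
        rw [Set.inter_comm] at ha hb
        exact hab' (puniq _ (π a).1.2 p hpc _ a.2 _ b.2 hpa hpb ha hb)
    · rintro (rfl | h)
      · rfl
      · apply (hπ b (π a)).1
        rcases ha with ha | ha
        · right; rw [← ha, Set.inter_comm]; exact h
        · by_contra hcon
          push Not at hcon
          obtain ⟨hab, hn⟩ := hcon
          obtain ⟨q, hqb, hqc⟩ := hn
          have hqa : q ∉ a.1 := fun h' => disj _ _ q h h' hqb
          exact hab (puniq a.1 a.2 q hqa _ b.2 _ (π a).1.2 hqb hqc h ha)
  apply no_matrix' cJ cI (Sum.elim (fun p a => if p ∈ a.1 then 1 else 0)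
    (fun c a => if c = π a then 1 else 0))
  intro a b
  rw [Fintype.sum_sum_type]
  simp only [Sum.elim_inl, Sum.elim_inr]
  have t2 : ∑ c : {ℓ : I // A ∈ ℓ.1}, (if c = π a then (1:ℚ) else 0) * (if c = π b then 1 else 0)
      = if π a = π b then 1 else 0 := by
    rw [Finset.sum_eq_single (π a)]
    · simp
    · intro c _ hc
      simp [hc]
    · intro h
      exact absurd (Finset.mem_univ _) h
  have t1 : ∑ p : P, (if p ∈ a.1 then (1:ℚ) else 0) * (if p ∈ b.1 then 1 else 0)
      = ((Finset.univ.filter (fun p => p ∈ a.1 ∧ p ∈ b.1)).card : ℚ) := by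
    rw [Finset.card_filter]
    push_cast
    apply Finset.sum_congr rfl
    intro p _
    by_cases h1 : p ∈ a.1 <;> by_cases h2 : p ∈ b.1 <;> simp [h1, h2]
  rw [t1, t2]
  by_cases hab : a = b
  · subst hab
    simp only [and_self, c6, if_true]
    norm_num
  · by_cases hd : a.1 ∩ b.1 = ∅
    · rw [if_pos ((πeq a b).2 (Or.inr hd)), if_neg hab]
      have : Finset.univ.filter (fun p => p ∈ a.1 ∧ p ∈ b.1) = ∅ := by
        apply Finset.filter_eq_empty_iff.2
        rintro p - ⟨h1, h2⟩
        exact disj _ _ p hd h1 h2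
      rw [this]; simp
    · have hn : ¬ π a = π b := by
        rw [πeq]; rintro (h | h)
        · exact hab h
        · exact hd h
      rw [if_neg hn, if_neg hab]
      obtain ⟨p, hpa, hpb⟩ := Set.nonempty_iff_ne_empty.2 hd
      have : Finset.univ.filter (fun p => p ∈ a.1 ∧ p ∈ b.1) = {p} := by
        ext q
        simp only [Finset.mem_filter, Finset.mem_univ, true_and, Finset.mem_singleton]
        constructor
        · rintro ⟨h1, h2⟩
          by_contra hqp
          exact hab (Subtype.ext (uniq q p hqp _ a.2 _ b.2 h1 hpa h2 hpb))
        · rintro rfl; exact ⟨hpa, hpb⟩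
      rw [this]; simp


/-- In any affine plane of order 6, the diagonals of every parallelogram are parallel:
if `A, B, C, D` are four (distinct) points, no three collinear, with line `AB` parallel
to line `CD` and line `BC` parallel to line `AD`, then line `AC` is parallel to line
`BD`. Here two lines are parallel when they are equal or disjoint. -/
theorem affine_plane_order_6_parallelogram_diagonals_parallel
    {P : Type} (L : Set (Set P))
    (h_unique_line : ∀ p q : P, p ≠ q → ∃! ℓ, ℓ ∈ L ∧ p ∈ ℓ ∧ q ∈ ℓ)
    (h_parallel : ∀ ℓ ∈ L, ∀ p ∉ ℓ, ∃! ℓ', ℓ' ∈ L ∧ p ∈ ℓ' ∧ ℓ ∩ ℓ' = ∅)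
    (h_nondeg : ∃ p q r : P, ∀ ℓ ∈ L, ¬(p ∈ ℓ ∧ q ∈ ℓ ∧ r ∈ ℓ))
    (h_order : ∀ ℓ ∈ L, ℓ.ncard = 6)
    (A B C D : P)
    (hAB : A ≠ B) (hAC : A ≠ C) (hAD : A ≠ D) (hBC : B ≠ C) (hBD : B ≠ D) (hCD : C ≠ D)
    (h_no3 : ∀ ℓ ∈ L, ¬(A ∈ ℓ ∧ B ∈ ℓ ∧ C ∈ ℓ) ∧ ¬(A ∈ ℓ ∧ B ∈ ℓ ∧ D ∈ ℓ) ∧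
      ¬(A ∈ ℓ ∧ C ∈ ℓ ∧ D ∈ ℓ) ∧ ¬(B ∈ ℓ ∧ C ∈ ℓ ∧ D ∈ ℓ))
    (lAB lCD lBC lAD lAC lBD : Set P)
    (hlAB : lAB ∈ L ∧ A ∈ lAB ∧ B ∈ lAB)
    (hlCD : lCD ∈ L ∧ C ∈ lCD ∧ D ∈ lCD)
    (hlBC : lBC ∈ L ∧ B ∈ lBC ∧ C ∈ lBC)
    (hlAD : lAD ∈ L ∧ A ∈ lAD ∧ D ∈ lAD)
    (hlAC : lAC ∈ L ∧ A ∈ lAC ∧ C ∈ lAC)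
    (hlBD : lBD ∈ L ∧ B ∈ lBD ∧ D ∈ lBD)
    (hpar₁ : lAB = lCD ∨ lAB ∩ lCD = ∅)
    (hpar₂ : lBC = lAD ∨ lBC ∩ lAD = ∅) :
    lAC = lBD ∨ lAC ∩ lBD = ∅ := by
  exact (no_plane L h_unique_line h_parallel h_order A B C hAB hAC hBC
    (fun ℓ hℓ => (h_no3 ℓ hℓ).1)).elim
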